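/- Let M be an infinite model of T_MSO(Fin). Then for each d ∈ ℕ with d ≥ 1, there is exactly one h with 0 < h ≤ d such that M ⊨ ρ_{d,h}. -/

import Mathlib

open FirstOrder FirstOrder.Language

namespace MSO

/-! ### The language `L_⊗` and its semantics -/

/-- The language `L_⊗`: a constant `⊥`, a unary relation `At`,
and two binary relations: `⊆` (encoded `true`) and `≤ᴱ` (encoded `false`). -/
def Lmso : Language where
  Functions := fun n => match n with | 0 => Unit | _ => Empty
  Relations := fun n => match n with | 1 => Unit | 2 => Bool | _ => Empty

/-- The constant symbol `⊥`. -/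
def botC : Lmso.Constants := Unit.unit
/-- The unary relation symbol `At`. -/
def atR : Lmso.Relations 1 := Unit.unit
/-- The binary relation symbol `⊆`. -/
def subR : Lmso.Relations 2 := true
/-- The binary relation symbol `≤ᴱ`. -/
def exleR : Lmso.Relations 2 := false

/-- The interpretation of `⊥` in an `L_⊗`-structure. -/
def botE (M : Type*) [Lmso.Structure M] : M := Structure.funMap botC ![]
/-- The interpretation of `At` in an `L_⊗`-structure. -/
def atE {M : Type*} [Lmso.Structure M] (a : M) : Prop := Structure.RelMap atR ![a]
/-- The interpretation of `⊆` in an `L_⊗`-structure. -/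
def subE {M : Type*} [Lmso.Structure M] (a b : M) : Prop := Structure.RelMap subR ![a, b]
/-- The interpretation of `≤ᴱ` in an `L_⊗`-structure. -/
def exleE {M : Type*} [Lmso.Structure M] (a b : M) : Prop := Structure.RelMap exleR ![a, b]

/-- The monadic second order version `M̃SO(α)` of a linear order `α`, as an `L_⊗`-structure:
the universe is the powerset of `α`, `⊆` is inclusion, `⊥` is `∅`, `At` holds of singletons,
and `A ≤ᴱ B` iff there are `a ∈ A` and `b ∈ B` with `a < b`. -/
instance msoStructure (α : Type*) [LinearOrder α] : Lmso.Structure (Set α) where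
  funMap := fun {n} f _ => match n, f with
    | 0, _ => (∅ : Set α)
  RelMap := fun {n} r v => match n, r with
    | 1, _ => ∃ a : α, v 0 = {a}
    | 2, true => v 0 ⊆ v 1
    | 2, false => ∃ a ∈ v 0, ∃ b ∈ v 1, a < b

/-- `MSO(n)`, the monadic second order version of the `n`-element linear order. -/
abbrev MSOn (n : ℕ) : Type := Set (Fin n)

/-- The operation `⊗` on `L_⊗`-structures: the universe is the product, `⊆` is componentwise,
`⊥` is the pair of bottoms, `At` holds of the atoms (minimal non-bottom elements) of the
resulting order, and `(A,B) ≤ᴱ (C,D)` iff (`A ≠ ⊥` and `D ≠ ⊥`), or `A ≤ᴱ C`, or `B ≤ᴱ D`. -/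
instance tensorStructure (M N : Type*) [Lmso.Structure M] [Lmso.Structure N] :
    Lmso.Structure (M × N) where
  funMap := fun {n} f _ => match n, f with
    | 0, _ => (botE M, botE N)
  RelMap := fun {n} r v => match n, r with
    | 1, _ => v 0 ≠ (botE M, botE N) ∧
        ∀ q : M × N, subE q.1 (v 0).1 → subE q.2 (v 0).2 →
          q = (botE M, botE N) ∨ q = v 0
    | 2, true => subE (v 0).1 (v 1).1 ∧ subE (v 0).2 (v 1).2
    | 2, false => ((v 0).1 ≠ botE M ∧ (v 1).2 ≠ botE N) ∨
        exleE (v 0).1 (v 1).1 ∨ exleE (v 0).2 (v 1).2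

/-! ### Formulas -/

/-- Bounded `L_⊗`-formulas with no free (outer) variables. -/
abbrev BF (n : ℕ) := Lmso.BoundedFormula Empty n

/-- The `i`-th de Bruijn variable as a term. -/
def tv {n : ℕ} (i : Fin n) : Lmso.Term (Empty ⊕ Fin n) := Term.var (Sum.inr i)
/-- The constant `⊥` as a term. -/
def tb {n : ℕ} : Lmso.Term (Empty ⊕ Fin n) := Constants.term botC

def sub' {n : ℕ} (i j : Fin n) : BF n := subR.boundedFormula₂ (tv i) (tv j)
def exle' {n : ℕ} (i j : Fin n) : BF n := exleR.boundedFormula₂ (tv i) (tv j)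
def at' {n : ℕ} (i : Fin n) : BF n := atR.boundedFormula₁ (tv i)
def eq' {n : ℕ} (i j : Fin n) : BF n := Term.bdEqual (tv i) (tv j)
def isBot' {n : ℕ} (i : Fin n) : BF n := Term.bdEqual (tv i) tb
def botSub' {n : ℕ} (i : Fin n) : BF n := subR.boundedFormula₂ tb (tv i)

/-- Finite conjunction. -/
def bigAnd {n : ℕ} (l : List (BF n)) : BF n := l.foldr (· ⊓ ·) ⊤
/-- Finite disjunction. -/
def bigOr {n : ℕ} (l : List (BF n)) : BF n := l.foldr (· ⊔ ·) ⊥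

/-- `k` is the meet of `i` and `j` (with respect to `⊆`). -/
def isMeet {n : ℕ} (k i j : Fin n) : BF n :=
  sub' k i ⊓ sub' k j ⊓
    ∀' ((sub' (Fin.last n) i.castSucc ⊓ sub' (Fin.last n) j.castSucc) ⟹
      sub' (Fin.last n) k.castSucc)

/-- `k` is the join of `i` and `j` (with respect to `⊆`). -/
def isJoin {n : ℕ} (k i j : Fin n) : BF n :=
  sub' i k ⊓ sub' j k ⊓
    ∀' ((sub' i.castSucc (Fin.last n) ⊓ sub' j.castSucc (Fin.last n)) ⟹
      sub' k.castSucc (Fin.last n))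

/-- The meet of `i` and `j` is `⊥`. -/
def meetIsBot {n : ℕ} (i j : Fin n) : BF n :=
  ∀' ((sub' (Fin.last n) i.castSucc ⊓ sub' (Fin.last n) j.castSucc) ⟹ isBot' (Fin.last n))

/-- The join of `i` and `j` is the top element. -/
def joinIsTop {n : ℕ} (i j : Fin n) : BF n :=
  ∀' ((sub' i.castSucc (Fin.last n) ⊓ sub' j.castSucc (Fin.last n)) ⟹
    ∀' (sub' (Fin.last (n + 1)) ((Fin.last n).castSucc)))

/-- `j` is a (Boolean) complement of `i`. -/
def isComplOf {n : ℕ} (j i : Fin n) : BF n := meetIsBot i j ⊓ joinIsTop i j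

/-- `i` is an atom: non-bottom, and minimal among non-bottom elements. -/
def isAtomDef {n : ℕ} (i : Fin n) : BF n :=
  ∼(isBot' i) ⊓
    ∀' (sub' (Fin.last n) i.castSucc ⟹ (isBot' (Fin.last n) ⊔ eq' (Fin.last n) i.castSucc))

/-! ### The base theory `T_base` -/

def axRefl : Lmso.Sentence := ∀' sub' 0 0
def axAntisymm : Lmso.Sentence := ∀' ∀' ((sub' 0 1 ⊓ sub' 1 0) ⟹ eq' 0 1)
def axTrans : Lmso.Sentence := ∀' ∀' ∀' ((sub' 0 1 ⊓ sub' 1 2) ⟹ sub' 0 2)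
def axBotLe : Lmso.Sentence := ∀' botSub' 0
def axTop : Lmso.Sentence := ∃' ∀' (sub' 1 0)
def axMeet : Lmso.Sentence := ∀' ∀' ∃' (isMeet 2 0 1)
def axJoin : Lmso.Sentence := ∀' ∀' ∃' (isJoin 2 0 1)
def axCompl : Lmso.Sentence := ∀' ∃' (isComplOf 1 0)
def axDistrib : Lmso.Sentence :=
  ∀' ∀' ∀' ∀' ∀' ∀' ∀' ∀'
    ((isMeet 3 0 1 ⊓ isMeet 4 0 2 ⊓ isJoin 5 1 2 ⊓ isMeet 6 0 5 ⊓ isJoin 7 3 4) ⟹ sub' 6 7)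
def axAt : Lmso.Sentence := ∀' (at' 0 ⇔ isAtomDef 0)
def axAtomic : Lmso.Sentence := ∀' (∼(isBot' 0) ⟹ ∃' (at' 1 ⊓ sub' 1 0))
def axIrrefl : Lmso.Sentence := ∀' (at' 0 ⟹ ∼(exle' 0 0))
def axTransAt : Lmso.Sentence :=
  ∀' ∀' ∀' ((at' 0 ⊓ at' 1 ⊓ at' 2 ⊓ exle' 0 1 ⊓ exle' 1 2) ⟹ exle' 0 2)
def axTrich : Lmso.Sentence :=
  ∀' ∀' ((at' 0 ⊓ at' 1) ⟹ (exle' 0 1 ⊔ eq' 0 1 ⊔ exle' 1 0))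
def axExleDef : Lmso.Sentence :=
  ∀' ∀' (exle' 0 1 ⇔ ∃' ∃' (at' 2 ⊓ at' 3 ⊓ sub' 2 0 ⊓ sub' 3 1 ⊓ exle' 2 3))

/-- The comprehension axiom for a formula `η(x; Y₁,…,Yₙ)` (with `x` the last variable):
`∀ Ȳ ∃ X ∀ x (At x → (x ⊆ X ↔ η(x; Ȳ)))`. -/
def compAx {n : ℕ} (η : BF (n + 1)) : Lmso.Sentence :=
  BoundedFormula.alls (∃' ∀' (at' (Fin.last (n + 1)) ⟹
    (sub' (Fin.last (n + 1)) ((Fin.last n).castSucc) ⇔ η.liftAt 1 n)))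

/-- The base theory `T_base`: an atomic Boolean algebra under `⊆` with bottom `⊥`, `At`
holding exactly of the atoms, `≤ᴱ` linearly ordering the atoms and determined by its
restriction to the atoms, together with the comprehension scheme. -/
def Tbase : Lmso.Theory :=
  {axRefl, axAntisymm, axTrans, axBotLe, axTop, axMeet, axJoin, axCompl, axDistrib,
    axAt, axAtomic, axIrrefl, axTransAt, axTrich, axExleDef} ∪
  ⋃ n : ℕ, Set.range (compAx (n := n))

/-! ### The theory `T_MSO(Fin)` -/

/-- `i` is the `≤ᴱ`-least atom. -/
def isLeastAtom {n : ℕ} (i : Fin n) : BF n :=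
  at' i ⊓ ∀' (at' (Fin.last n) ⟹ ∼(exle' (Fin.last n) i.castSucc))

/-- `i` is the `≤ᴱ`-greatest atom. -/
def isGreatestAtom {n : ℕ} (i : Fin n) : BF n :=
  at' i ⊓ ∀' (at' (Fin.last n) ⟹ ∼(exle' i.castSucc (Fin.last n)))

/-- `j` is the immediate `≤ᴱ`-successor of the atom `i`. -/
def isSuccOf {n : ℕ} (j i : Fin n) : BF n :=
  at' i ⊓ at' j ⊓ exle' i j ⊓
    ∀' ((at' (Fin.last n) ⊓ exle' i.castSucc (Fin.last n)) ⟹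
      (eq' (Fin.last n) j.castSucc ⊔ exle' j.castSucc (Fin.last n)))

def axLeastAtom : Lmso.Sentence := (∃' at' 0) ⟹ ∃' isLeastAtom 0
def axGreatestAtom : Lmso.Sentence := (∃' at' 0) ⟹ ∃' isGreatestAtom 0
def axSucc : Lmso.Sentence :=
  ∀' ((at' 0 ⊓ ∃' (at' 1 ⊓ exle' 0 1)) ⟹ ∃' isSuccOf 1 0)
def axPred : Lmso.Sentence :=
  ∀' ((at' 0 ⊓ ∃' (at' 1 ⊓ exle' 1 0)) ⟹ ∃' isSuccOf 0 1)
def axLeastIn : Lmso.Sentence :=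
  ∀' (∼(isBot' 0) ⟹ ∃' (at' 1 ⊓ sub' 1 0 ⊓ ∀' ((at' 2 ⊓ sub' 2 0) ⟹ ∼(exle' 2 1))))

/-- The theory `T_MSO(Fin)`: `T_base` together with axioms saying that the ordering of the
atoms is discrete with endpoints, and every non-bottom element contains a least atom. -/
def TMSOFin : Lmso.Theory :=
  Tbase ∪ {axLeastAtom, axGreatestAtom, axSucc, axPred, axLeastIn}

/-! ### Quantifier rank, unnested formulas, and `≈ₖ` -/

/-- Quantifier rank of a bounded formula. -/
def qr : ∀ {n : ℕ}, BF n → ℕ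
  | _, BoundedFormula.falsum => 0
  | _, BoundedFormula.equal _ _ => 0
  | _, BoundedFormula.rel _ _ => 0
  | _, BoundedFormula.imp f g => max (qr f) (qr g)
  | _, BoundedFormula.all f => qr f + 1

/-- A formula is unnested if every atomic subformula is of one of the forms
`x = y`, `c = y`, or `R x̄` with the `xᵢ`, `y` variables (Hodges). -/
def IsUnnested : ∀ {n : ℕ}, BF n → Prop
  | _, BoundedFormula.falsum => True
  | _, BoundedFormula.equal s t =>
      (∃ i j, s = Term.var i ∧ t = Term.var j) ∨
      (∃ (c : Lmso.Constants) (j : _), s = Constants.term c ∧ t = Term.var j)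
  | _, BoundedFormula.rel _ ts => ∀ i, ∃ j, ts i = Term.var j
  | _, BoundedFormula.imp f g => IsUnnested f ∧ IsUnnested g
  | _, BoundedFormula.all f => IsUnnested f

/-- `M ≈ₖ N` : `M` and `N` satisfy the same unnested `L_⊗`-sentences of quantifier
rank at most `k`. -/
def EquivK (k : ℕ) (M N : Type*) [Lmso.Structure M] [Lmso.Structure N] : Prop :=
  ∀ φ : Lmso.Sentence, IsUnnested φ → qr φ ≤ k → (M ⊨ φ ↔ N ⊨ φ)

/-! ### The sentences `ρ_{d,h}`, `ψ_{>n}`, `ψ_{=n}` -/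

/-- The index (in `Fin d`) of `A_h` among `A₁, …, A_d`, identifying `h = 0` with `h = d`. -/
def aIdx (d h : ℕ) (hd : 0 < d) : Fin d := ⟨(h + d - 1) % d, Nat.mod_lt _ hd⟩

/-- The cyclic successor on the indices `{1, …, d}`. -/
def cyc {d : ℕ} (j : Fin d) : Fin d := ⟨((j : ℕ) + 1) % d, Nat.mod_lt _ j.pos⟩

/-- The sentence `ρ_{d,h}`: there is a partition of the atoms into `d` non-bottom elements
`A₁, …, A_d` such that the least atom is in `A₁`, the immediate successor of an atom lying in
`A_j` lies in `A_{j+1}` (cyclically), and the greatest atom is in `A_h`. -/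
def rho (d h : ℕ) : Lmso.Sentence :=
  if hd : 0 < d then
    BoundedFormula.exs (n := d) (
      -- each `A_i` is non-bottom
      bigAnd ((List.finRange d).map fun i => ∼(isBot' i)) ⊓
      -- every atom lies in some `A_i`
      (∀' (at' (Fin.last d) ⟹
        bigOr ((List.finRange d).map fun i => sub' (Fin.last d) i.castSucc))) ⊓
      -- the `A_i` are pairwise disjoint on atoms
      bigAnd ((List.finRange d).flatMap fun i => (List.finRange d).filterMap fun j =>
        if i.val < j.val then
          some (∀' (at' (Fin.last d) ⟹
            ∼(sub' (Fin.last d) i.castSucc ⊓ sub' (Fin.last d) j.castSucc)))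
        else none) ⊓
      -- the least atom lies in `A₁`
      (∀' (isLeastAtom (Fin.last d) ⟹ sub' (Fin.last d) ((aIdx d 1 hd).castSucc))) ⊓
      -- immediate successors move cyclically through the `A_j`
      bigAnd ((List.finRange d).map fun j =>
        ∀' ∀' ((sub' ((Fin.last d).castSucc) (j.castSucc.castSucc) ⊓
            isSuccOf (Fin.last (d + 1)) ((Fin.last d).castSucc)) ⟹
          sub' (Fin.last (d + 1)) ((cyc j).castSucc.castSucc))) ⊓
      -- the greatest atom lies in `A_h`
      (∀' (isGreatestAtom (Fin.last d) ⟹ sub' (Fin.last d) ((aIdx d h hd).castSucc))))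
  else ⊥

/-- The list of formulas `xᵢ ≠ xⱼ` for `i < j < n`. -/
def distinctPairs (n : ℕ) : List (BF n) :=
  (List.finRange n).flatMap fun i => (List.finRange n).filterMap fun j =>
    if i.val < j.val then some (∼(eq' i j)) else none

/-- `ψ_{>n}` : there exist at least `n + 1` distinct atoms. -/
def psiGt (n : ℕ) : Lmso.Sentence :=
  BoundedFormula.exs (n := n + 1)
    (bigAnd ((List.finRange (n + 1)).map fun i => at' i) ⊓ bigAnd (distinctPairs (n + 1)))

/-- `ψ_{=n}` : there exist exactly `n` distinct atoms. -/
def psiEq (n : ℕ) : Lmso.Sentence :=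
  BoundedFormula.exs (n := n)
    (bigAnd ((List.finRange n).map fun i => at' i) ⊓ bigAnd (distinctPairs n) ⊓
      ∀' (at' (Fin.last n) ⟹ bigOr ((List.finRange n).map fun i => eq' (Fin.last n) i.castSucc)))

/-! ### Residue functions and the theories `T_r̃` -/

/-- A residue function `ℙ × ℕ_{>0} → ℕ` (conditions imposed only at primes `p` and `j ≥ 1`):
`r(p,j) < p^j` and `r(p,j+1) ≡ r(p,j) [MOD p^j]`. -/
def IsResidueFunction (r : ℕ → ℕ → ℕ) : Prop :=
  ∀ p j : ℕ, p.Prime → 1 ≤ j → r p j < p ^ j ∧ r p (j + 1) ≡ r p j [MOD p ^ j]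

/-- A function `ℕ_{>1} → ℕ` is a residue function if it arises from a residue function
`ℙ × ℕ_{>0} → ℕ` as in the paper (conditions imposed only for `d > 1`). -/
def IsResidueFunctionTilde (rt : ℕ → ℕ) : Prop :=
  ∃ r : ℕ → ℕ → ℕ, IsResidueFunction r ∧
    ∀ d : ℕ, 1 < d → rt d < d ∧
      ∀ p j : ℕ, p.Prime → 1 ≤ j → p ^ j ∣ d → rt d ≡ r p j [MOD p ^ j]

/-- The theory `T_r̃ = T_MSO(Fin) ∪ {ψ_{>n} : n ∈ ℕ} ∪ {ρ_{d,r̃(d)} : d > 1}`. -/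
def Trt (rt : ℕ → ℕ) : Lmso.Theory :=
  TMSOFin ∪ Set.range psiGt ∪ {σ : Lmso.Sentence | ∃ d : ℕ, 1 < d ∧ σ = rho d (rt d)}

/-! ### Relativization and the sum of sentences -/

/-- Relativization of a formula to the elements `⊆ v`:
each quantifier `∀ Z (…)` becomes `∀ Z (Z ⊆ v → …)`. -/
def relv : ∀ {n : ℕ}, BF n → Fin n → BF n
  | _, BoundedFormula.falsum, _ => BoundedFormula.falsum
  | _, BoundedFormula.equal s t, _ => BoundedFormula.equal s t
  | _, BoundedFormula.rel r ts, _ => BoundedFormula.rel r ts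
  | _, BoundedFormula.imp f g, v => (relv f v).imp (relv g v)
  | n, BoundedFormula.all f, v =>
      BoundedFormula.all (sub' (Fin.last n) v.castSucc ⟹ relv f v.castSucc)

/-- `i` is downward closed with respect to the `≤ᴱ`-ordering of the atoms. -/
def dwcl' {n : ℕ} (i : Fin n) : BF n :=
  ∀' ∀' ((at' ((Fin.last n).castSucc) ⊓ at' (Fin.last (n + 1)) ⊓
      sub' ((Fin.last n).castSucc) (i.castSucc.castSucc) ⊓
      exle' (Fin.last (n + 1)) ((Fin.last n).castSucc)) ⟹
    sub' (Fin.last (n + 1)) (i.castSucc.castSucc))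

/-- The sentence `φ + ψ` : `∃ X (X downward closed ∧ φ^X ∧ ψ^(Xᶜ))`
(with the complement `Xᶜ` introduced by an existential quantifier). -/
def plusSent (φ ψ : Lmso.Sentence) : Lmso.Sentence :=
  ∃' ∃' (dwcl' (0 : Fin 2) ⊓ isComplOf (1 : Fin 2) (0 : Fin 2) ⊓
    relv (φ.liftAt 2 0) (0 : Fin 2) ⊓ relv (ψ.liftAt 2 0) (1 : Fin 2))

/-! ### `FSpec` and ultimate periodicity -/

/-- `FSpec φ` : the set of `n ∈ ℕ` such that `MSO(n) ⊨ φ`. -/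
def FSpec (φ : Lmso.Sentence) : Set ℕ := {n : ℕ | MSOn n ⊨ φ}

/-- A set of naturals is ultimately periodic. -/
def UltPeriodic (S : Set ℕ) : Prop :=
  ∃ N d : ℕ, 0 < d ∧ ∀ n : ℕ, N < n → (n ∈ S ↔ n + d ∈ S)

/-! ### The language `L_MO = {⊆, <}` -/

/-- The language `L_MO` with two binary relations: `⊆` (encoded `true`) and `<`
(encoded `false`). -/
def Lmo : Language where
  Functions := fun _ => Empty
  Relations := fun n => match n with | 2 => Bool | _ => Empty

/-- The monadic second order version `MSO(α)` of a linear order `α` as an `L_MO`-structure: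
`⊆` is inclusion and `<` is the ordering of `α` on singletons. -/
instance moStructure (α : Type*) [LinearOrder α] : Lmo.Structure (Set α) where
  funMap := fun f _ => f.elim
  RelMap := fun {n} r v => match n, r with
    | 2, true => v 0 ⊆ v 1
    | 2, false => ∃ a b : α, v 0 = {a} ∧ v 1 = {b} ∧ a < b

/-! ### Semantics of the basic formulas -/

section Realize

variable {M : Type*} [Lmso.Structure M] {n : ℕ} {e : Empty → M} {v : Fin n → M}

@[simp]
theorem realize_sub' {i j : Fin n} : (sub' i j).Realize e v ↔ subE (v i) (v j) := by
  simp [sub', tv, subE, BoundedFormula.realize_rel₂]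

@[simp]
theorem realize_exle' {i j : Fin n} : (exle' i j).Realize e v ↔ exleE (v i) (v j) := by
  simp [exle', tv, exleE, BoundedFormula.realize_rel₂]

@[simp]
theorem realize_at' {i : Fin n} : (at' i).Realize e v ↔ atE (v i) := by
  simp [at', tv, atE, BoundedFormula.realize_rel₁]

@[simp]
theorem realize_eq' {i j : Fin n} : (eq' i j).Realize e v ↔ v i = v j := by
  simp [eq', tv, BoundedFormula.realize_bdEqual]

theorem realize_tb : (tb (n := n)).realize (Sum.elim e v) = botE M := by
  rw [tb, Term.realize_constants, ← funMap_eq_coe_constants, botE]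

@[simp]
theorem realize_isBot' {i : Fin n} : (isBot' i).Realize e v ↔ v i = botE M := by
  simp [isBot', tv, BoundedFormula.realize_bdEqual, realize_tb]

@[simp]
theorem realize_botSub' {i : Fin n} : (botSub' i).Realize e v ↔ subE (botE M) (v i) := by
  simp [botSub', tv, subE, BoundedFormula.realize_rel₂, realize_tb]

/-- `y` is the immediate successor of the atom `x`. -/
def SuccE (x y : M) : Prop :=
  atE x ∧ atE y ∧ exleE x y ∧ ∀ z, atE z → exleE x z → z = y ∨ exleE y z

/-- `x` is the least atom. -/
def LeastE (x : M) : Prop := atE x ∧ ∀ y, atE y → ¬ exleE y x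

/-- `x` is the greatest atom. -/
def GreatestE (x : M) : Prop := atE x ∧ ∀ y, atE y → ¬ exleE x y

@[simp]
theorem realize_isLeastAtom {i : Fin n} : (isLeastAtom i).Realize e v ↔ LeastE (v i) := by
  simp [isLeastAtom, LeastE]

@[simp]
theorem realize_isGreatestAtom {i : Fin n} :
    (isGreatestAtom i).Realize e v ↔ GreatestE (v i) := by
  simp [isGreatestAtom, GreatestE]

@[simp]
theorem realize_isSuccOf {i j : Fin n} : (isSuccOf j i).Realize e v ↔ SuccE (v i) (v j) := by
  simp [isSuccOf, SuccE, and_assoc]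

@[simp]
theorem realize_bigAnd {l : List (BF n)} :
    (bigAnd l).Realize e v ↔ ∀ φ ∈ l, φ.Realize e v :=
  BoundedFormula.realize_foldr_inf l e v

@[simp]
theorem realize_bigOr {l : List (BF n)} :
    (bigOr l).Realize e v ↔ ∃ φ ∈ l, φ.Realize e v :=
  BoundedFormula.realize_foldr_sup l e v

theorem realize_rho (d h : ℕ) (hd : 0 < d) : M ⊨ rho d h ↔ ∃ A : Fin d → M,
    (∀ i, A i ≠ botE M) ∧
    (∀ x, atE x → ∃ i, subE x (A i)) ∧
    (∀ i j, i < j → ∀ x, atE x → ¬ (subE x (A i) ∧ subE x (A j))) ∧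
    (∀ x, LeastE x → subE x (A (aIdx d 1 hd))) ∧
    (∀ i x y, subE x (A i) → SuccE x y → subE y (A (cyc i))) ∧
    (∀ x, GreatestE x → subE x (A (aIdx d h hd))) := by
  rw [rho, dif_pos hd, Sentence.Realize, BoundedFormula.realize_exs]
  refine exists_congr fun A => ?_
  simp only [BoundedFormula.realize_inf, realize_bigAnd, List.mem_map, List.mem_finRange,
    true_and, forall_exists_index, forall_apply_eq_imp_iff, BoundedFormula.realize_not,
    realize_isBot', BoundedFormula.realize_all, BoundedFormula.realize_imp, realize_at',
    Fin.snoc_last, realize_bigOr, exists_exists_eq_and, realize_sub', Fin.snoc_castSucc,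
    List.mem_flatMap, List.mem_filterMap, Option.ite_none_right_eq_some, Option.some.injEq,
    and_imp, realize_isLeastAtom, realize_isSuccOf, realize_isGreatestAtom, and_assoc, ne_eq,
    not_and]
  refine and_congr Iff.rfl (and_congr Iff.rfl (and_congr ?_ Iff.rfl))
  constructor
  · intro H i j hij x hx hi hj
    have := H _ i j hij rfl
    rw [BoundedFormula.realize_all] at this
    simpa [hx, hi, hj] using this x
  · rintro H _ i j hij rfl
    rw [BoundedFormula.realize_all]
    intro x
    simpa using H i j hij x

end Realize

/-! ### First-order consequences of the axioms -/

section Axioms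

variable {M : Type*} [Lmso.Structure M]

theorem realize_of_mem_base (hM : M ⊨ TMSOFin) {φ : Lmso.Sentence}
    (hφ : φ ∈ Tbase) : M ⊨ φ :=
  Theory.realize_sentence_of_mem TMSOFin (Or.inl hφ)

variable (hM : M ⊨ TMSOFin)
include hM

theorem subE_antisymm {a b : M} (h : subE a b) (h' : subE b a) : a = b := by
  have := realize_of_mem_base hM (φ := axAntisymm) (by simp [Tbase])
  simp [axAntisymm, Sentence.Realize, Formula.Realize, Fin.snoc] at this
  exact this a b h h'

theorem subE_refl (a : M) : subE a a := by
  have := realize_of_mem_base hM (φ := axRefl) (by simp [Tbase])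
  simp [axRefl, Sentence.Realize, Formula.Realize, Fin.snoc] at this
  exact this a

theorem subE_trans {a b c : M} (h : subE a b) (h' : subE b c) : subE a c := by
  have := realize_of_mem_base hM (φ := axTrans) (by simp [Tbase])
  simp [axTrans, Sentence.Realize, Formula.Realize, Fin.snoc] at this
  exact this a b c h h'

theorem botE_subE (a : M) : subE (botE M) a := by
  have := realize_of_mem_base hM (φ := axBotLe) (by simp [Tbase])
  simp [axBotLe, Sentence.Realize, Formula.Realize, Fin.snoc] at this
  exact this a

theorem exists_meet (a b : M) : ∃ c, (subE c a ∧ subE c b) ∧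
    ∀ x, subE x a → subE x b → subE x c := by
  have := realize_of_mem_base hM (φ := axMeet) (by simp [Tbase])
  simp [axMeet, isMeet, Sentence.Realize, Formula.Realize, Fin.snoc] at this
  exact this a b

theorem exists_join (a b : M) : ∃ c, (subE a c ∧ subE b c) ∧
    ∀ x, subE a x → subE b x → subE c x := by
  have := realize_of_mem_base hM (φ := axJoin) (by simp [Tbase])
  simp [axJoin, isJoin, Sentence.Realize, Formula.Realize, Fin.snoc] at this
  exact this a b

theorem exists_compl (a : M) : ∃ b, (∀ x, subE x a → subE x b → x = botE M) ∧
    ∀ x, subE a x → subE b x → ∀ y, subE y x := by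
  have := realize_of_mem_base hM (φ := axCompl) (by simp [Tbase])
  simp [axCompl, isComplOf, meetIsBot, joinIsTop, Sentence.Realize, Formula.Realize,
    Fin.snoc] at this
  exact this a

theorem distrib {a b c ab ac bc abc r : M}
    (h₁ : (subE ab a ∧ subE ab b) ∧ ∀ x, subE x a → subE x b → subE x ab)
    (h₂ : (subE ac a ∧ subE ac c) ∧ ∀ x, subE x a → subE x c → subE x ac)
    (h₃ : (subE b bc ∧ subE c bc) ∧ ∀ x, subE b x → subE c x → subE bc x)
    (h₄ : (subE abc a ∧ subE abc bc) ∧ ∀ x, subE x a → subE x bc → subE x abc)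
    (h₅ : (subE ab r ∧ subE ac r) ∧ ∀ x, subE ab x → subE ac x → subE r x) :
    subE abc r := by
  have := realize_of_mem_base hM (φ := axDistrib) (by simp [Tbase])
  simp [axDistrib, isMeet, isJoin, Sentence.Realize, Formula.Realize, Fin.snoc] at this
  exact this a b c ab ac bc abc r h₁.1.1 h₁.1.2 h₁.2 h₂.1.1 h₂.1.2 h₂.2 h₃.1.1 h₃.1.2 h₃.2
    h₄.1.1 h₄.1.2 h₄.2 h₅.1.1 h₅.1.2 h₅.2

theorem atE_iff {a : M} :
    atE a ↔ a ≠ botE M ∧ ∀ x, subE x a → x = botE M ∨ x = a := by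
  have := realize_of_mem_base hM (φ := axAt) (by simp [Tbase])
  simp [axAt, isAtomDef, Sentence.Realize, Formula.Realize, Fin.snoc] at this
  exact this a

theorem exists_atE_subE {a : M} (h : a ≠ botE M) : ∃ x, atE x ∧ subE x a := by
  have := realize_of_mem_base hM (φ := axAtomic) (by simp [Tbase])
  simp [axAtomic, Sentence.Realize, Formula.Realize, Fin.snoc] at this
  exact this a h

theorem exleE_irrefl {a : M} (h : atE a) : ¬ exleE a a := by
  have := realize_of_mem_base hM (φ := axIrrefl) (by simp [Tbase])
  simp [axIrrefl, Sentence.Realize, Formula.Realize, Fin.snoc] at this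
  exact this a h

theorem exleE_trans {a b c : M} (ha : atE a) (hb : atE b) (hc : atE c)
    (h : exleE a b) (h' : exleE b c) : exleE a c := by
  have := realize_of_mem_base hM (φ := axTransAt) (by simp [Tbase])
  simp [axTransAt, Sentence.Realize, Formula.Realize, Fin.snoc] at this
  exact this a b c ha hb hc h h'

theorem exleE_trichotomy {a b : M} (ha : atE a) (hb : atE b) :
    exleE a b ∨ a = b ∨ exleE b a := by
  have := realize_of_mem_base hM (φ := axTrich) (by simp [Tbase])
  simp [axTrich, Sentence.Realize, Formula.Realize, Fin.snoc] at this
  exact or_assoc.1 (this a b ha hb)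

theorem exists_leastE {a : M} (ha : atE a) : ∃ x : M, LeastE x := by
  have := Theory.realize_sentence_of_mem (M := M) TMSOFin (φ := axLeastAtom)
    (by simp [TMSOFin])
  simp [axLeastAtom, Sentence.Realize, Formula.Realize, Fin.snoc] at this
  exact this a ha

theorem exists_greatestE {a : M} (ha : atE a) : ∃ x : M, GreatestE x := by
  have := Theory.realize_sentence_of_mem (M := M) TMSOFin (φ := axGreatestAtom)
    (by simp [TMSOFin])
  simp [axGreatestAtom, Sentence.Realize, Formula.Realize, Fin.snoc] at this
  exact this a ha

theorem exists_succE {a b : M} (ha : atE a) (hb : atE b) (h : exleE a b) :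
    ∃ x, SuccE a x := by
  have := Theory.realize_sentence_of_mem (M := M) TMSOFin (φ := axSucc) (by simp [TMSOFin])
  simp [axSucc, Sentence.Realize, Formula.Realize, Fin.snoc] at this
  exact this a ha b hb h

theorem exists_predE {a b : M} (ha : atE a) (hb : atE b) (h : exleE b a) :
    ∃ x, SuccE x a := by
  have := Theory.realize_sentence_of_mem (M := M) TMSOFin (φ := axPred) (by simp [TMSOFin])
  simp [axPred, Sentence.Realize, Formula.Realize, Fin.snoc] at this
  exact this a ha b hb h

theorem exists_least_atE_subE {a : M} (h : a ≠ botE M) :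
    ∃ x, (atE x ∧ subE x a) ∧ ∀ y, atE y → subE y a → ¬ exleE y x := by
  have := Theory.realize_sentence_of_mem (M := M) TMSOFin (φ := axLeastIn)
    (by simp [TMSOFin])
  simp [axLeastIn, Sentence.Realize, Formula.Realize, Fin.snoc] at this
  exact this a h

theorem comprehension {n : ℕ} (η : BF (n + 1)) (v : Fin n → M) :
    ∃ X : M, ∀ x, atE x → (subE x X ↔ η.Realize default (Fin.snoc v x)) := by
  have := realize_of_mem_base hM (φ := compAx η)
    (Or.inr (Set.mem_iUnion.2 ⟨n, Set.mem_range_self η⟩))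
  rw [compAx, Sentence.Realize, BoundedFormula.realize_alls] at this
  obtain ⟨X, hX⟩ := BoundedFormula.realize_ex.1 (this v)
  refine ⟨X, fun x hx => ?_⟩
  have := hX x
  simp [hx, BoundedFormula.realize_liftAt_one] at this
  rw [this, iff_eq_eq]
  congr 1
  funext i
  refine Fin.lastCases ?_ (fun i => ?_) i
  · simp
  · simp

end Axioms

/-! ### Atoms -/

section Atoms

variable {M : Type*} [Lmso.Structure M] (hM : M ⊨ TMSOFin)
include hM

theorem not_subE_botE {x : M} (hx : atE x) : ¬ subE x (botE M) := fun h =>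
  ((atE_iff hM).1 hx).1 (subE_antisymm hM h (botE_subE hM x))

theorem ne_botE_of_subE {x a : M} (hx : atE x) (h : subE x a) : a ≠ botE M := by
  rintro rfl
  exact not_subE_botE hM hx h

theorem subE_iff_eq {x y : M} (hx : atE x) (hy : atE y) : subE x y ↔ x = y := by
  refine ⟨fun h => ?_, fun h => h ▸ subE_refl hM x⟩
  exact (((atE_iff hM).1 hy).2 x h).resolve_left ((atE_iff hM).1 hx).1

theorem subE_of_forall_atE {a b : M} (h : ∀ x, atE x → subE x a → subE x b) : subE a b := by
  obtain ⟨c, hc, hc'⟩ := exists_compl hM b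
  obtain ⟨ab, hab⟩ := exists_meet hM a b
  obtain ⟨ac, hac⟩ := exists_meet hM a c
  obtain ⟨bc, hbc⟩ := exists_join hM b c
  obtain ⟨abc, habc⟩ := exists_meet hM a bc
  obtain ⟨r, hr⟩ := exists_join hM ab ac
  have hbot : ac = botE M := by
    by_contra hne
    obtain ⟨x, hx, hxac⟩ := exists_atE_subE hM hne
    have hxb := h x hx (subE_trans hM hxac hac.1.1)
    exact ((atE_iff hM).1 hx).1 (hc x hxb (subE_trans hM hxac hac.1.2))
  have h₁ : subE a abc := habc.2 a (subE_refl hM a) (hc' bc hbc.1.1 hbc.1.2 a)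
  have h₂ : subE abc r := distrib hM hab hac hbc habc hr
  have h₃ : subE r ab := hr.2 ab (subE_refl hM ab) (hbot ▸ botE_subE hM ab)
  exact subE_trans hM h₁ (subE_trans hM h₂ (subE_trans hM h₃ hab.1.2))

theorem infinite_setOf_atE [Infinite M] : {x : M | atE x}.Infinite := by
  intro hfin
  have : Finite {x : M | atE x} := hfin
  refine not_finite_iff_infinite.2 ‹Infinite M›
    (Finite.of_injective (fun a : M => {x : {x : M | atE x} | subE x.1 a}) fun a b hab => ?_)
  have key : ∀ x, atE x → (subE x a ↔ subE x b) := fun x hx =>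
    Set.ext_iff.1 hab ⟨x, hx⟩
  exact subE_antisymm hM (subE_of_forall_atE hM fun x hx => (key x hx).1)
    (subE_of_forall_atE hM fun x hx => (key x hx).2)

theorem SuccE.not_exleE {x y z : M} (h : SuccE x z) (hy : atE y) (hyx : ¬ exleE x y) :
    ¬ exleE z y := fun hzy => hyx (exleE_trans hM h.1 h.2.1 hy h.2.2.1 hzy)

omit hM in
theorem SuccE.not_exleE_or_eq {x y z : M} (h : SuccE x z) (hy : atE y) (hyz : ¬ exleE z y) :
    ¬ exleE x y ∨ y = z := by
  by_cases hxy : exleE x y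
  · exact Or.inr ((h.2.2.2 y hy hxy).resolve_right hyz)
  · exact Or.inl hxy

theorem exleE_asymm {x y : M} (hx : atE x) (hy : atE y) (h : exleE x y) : ¬ exleE y x :=
  fun h' => exleE_irrefl hM hx (exleE_trans hM hx hy hx h h')

theorem SuccE.not_exleE_of_succE {x y z : M} (hx : SuccE x z) (hy : SuccE y z) :
    ¬ exleE x y := by
  intro h
  rcases hx.2.2.2 y hy.1 h with rfl | h'
  · exact exleE_irrefl hM hy.1 hy.2.2.1
  · exact exleE_asymm hM hy.1 hy.2.1 hy.2.2.1 h'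

theorem SuccE.left_unique {x y z : M} (hx : SuccE x z) (hy : SuccE y z) : x = y :=
  ((exleE_trichotomy hM hx.1 hy.1).resolve_left (hx.not_exleE_of_succE hM hy)).resolve_right
    (hy.not_exleE_of_succE hM hx)

theorem LeastE.unique {x y : M} (hx : LeastE x) (hy : LeastE y) : x = y :=
  ((exleE_trichotomy hM hx.1 hy.1).resolve_left (hy.2 x hx.1)).resolve_right (hx.2 y hy.1)

end Atoms

/-! ### Definable predicates, comprehension and induction -/

section Definable

variable {M : Type*} [Lmso.Structure M] {α : Type*}

/-- `P` is the predicate defined by some `L_⊗`-formula without parameters. -/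
def IsDef (P : (α → M) → Prop) : Prop :=
  ∃ φ : Lmso.Formula α, ∀ v, φ.Realize v ↔ P v

namespace IsDef

variable {P Q : (α → M) → Prop}

theorem sub (a b : α) : IsDef fun v : α → M => subE (v a) (v b) :=
  ⟨subR.formula₂ (Term.var a) (Term.var b), fun v => by simp [Formula.realize_rel₂, subE]⟩

theorem exle (a b : α) : IsDef fun v : α → M => exleE (v a) (v b) :=
  ⟨exleR.formula₂ (Term.var a) (Term.var b), fun v => by simp [Formula.realize_rel₂, exleE]⟩

theorem atom (a : α) : IsDef fun v : α → M => atE (v a) :=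
  ⟨atR.formula₁ (Term.var a), fun v => by simp [Formula.realize_rel₁, atE]⟩

theorem eq (a b : α) : IsDef fun v : α → M => v a = v b :=
  ⟨Term.equal (Term.var a) (Term.var b), fun v => by simp⟩

theorem const (p : Prop) : IsDef fun _ : α → M => p := by
  by_cases hp : p
  · exact ⟨⊤, fun v => by simp [hp]⟩
  · exact ⟨⊥, fun v => by simp [hp]⟩

theorem not (hP : IsDef P) : IsDef fun v => ¬ P v := by
  obtain ⟨φ, hφ⟩ := hP
  exact ⟨φ.not, fun v => by simp [hφ]⟩

theorem imp (hP : IsDef P) (hQ : IsDef Q) : IsDef fun v => P v → Q v := by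
  obtain ⟨φ, hφ⟩ := hP
  obtain ⟨ψ, hψ⟩ := hQ
  exact ⟨φ.imp ψ, fun v => by simp [hφ, hψ]⟩

theorem and (hP : IsDef P) (hQ : IsDef Q) : IsDef fun v => P v ∧ Q v := by
  obtain ⟨φ, hφ⟩ := hP
  obtain ⟨ψ, hψ⟩ := hQ
  exact ⟨φ ⊓ ψ, fun v => by simp [hφ, hψ]⟩

theorem or (hP : IsDef P) (hQ : IsDef Q) : IsDef fun v => P v ∨ Q v := by
  obtain ⟨φ, hφ⟩ := hP
  obtain ⟨ψ, hψ⟩ := hQ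
  exact ⟨φ ⊔ ψ, fun v => by simp [hφ, hψ]⟩

theorem iff (hP : IsDef P) (hQ : IsDef Q) : IsDef fun v => (P v ↔ Q v) := by
  obtain ⟨φ, hφ⟩ := hP
  obtain ⟨ψ, hψ⟩ := hQ
  exact ⟨φ.iff ψ, fun v => by simp [hφ, hψ]⟩

theorem forall_finite {ι : Type*} [Finite ι] {P : ι → (α → M) → Prop} (h : ∀ i, IsDef (P i)) :
    IsDef fun v => ∀ i, P i v := by
  choose φ hφ using h
  exact ⟨Formula.iInf φ, fun v => by simp [hφ]⟩

theorem exists_finite {ι : Type*} [Finite ι] {P : ι → (α → M) → Prop} (h : ∀ i, IsDef (P i)) :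
    IsDef fun v => ∃ i, P i v := by
  choose φ hφ using h
  exact ⟨Formula.iSup φ, fun v => by simp [hφ]⟩

theorem exists_tuple {β : Type*} [Finite β] {P : (α → M) → (β → M) → Prop}
    (h : IsDef fun v : α ⊕ β → M => P (fun a => v (.inl a)) fun b => v (.inr b)) :
    IsDef fun v => ∃ w, P v w := by
  obtain ⟨φ, hφ⟩ := h
  exact ⟨φ.iExs β, fun v => by simp [Formula.realize_iExs, hφ]⟩

theorem all {P : (α → M) → M → Prop}
    (h : IsDef fun v : α ⊕ Unit → M => P (fun a => v (.inl a)) (v (.inr ()))) :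
    IsDef fun v => ∀ x, P v x := by
  obtain ⟨φ, hφ⟩ := h
  refine ⟨φ.iAlls Unit, fun v => ?_⟩
  simp only [Formula.realize_iAlls, hφ, Sum.elim_inl, Sum.elim_inr]
  exact ⟨fun H x => H fun _ => x, fun H w => H _⟩

theorem succ (a b : α) : IsDef fun v : α → M => SuccE (v a) (v b) :=
  (atom a).and <| (atom b).and <| (exle a b).and <|
    all <| (atom _).imp <| (exle _ _).imp <| (eq _ _).or (exle _ _)

theorem least (a : α) : IsDef fun v : α → M => LeastE (v a) :=
  (atom a).and <| all <| (atom _).imp <| (exle _ _).not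

end IsDef

variable (hM : M ⊨ TMSOFin) [Finite α] {P : (α → M) → M → Prop}
  (h : IsDef fun v : α ⊕ Unit → M => P (fun a => v (.inl a)) (v (.inr ())))
include hM h

theorem IsDef.comprehension (v : α → M) : ∃ X : M, ∀ x, atE x → (subE x X ↔ P v x) := by
  obtain ⟨φ, hφ⟩ := h
  obtain ⟨n, ⟨e⟩⟩ := Finite.exists_equiv_fin α
  obtain ⟨X, hX⟩ := MSO.comprehension hM (n := n) (BoundedFormula.relabel (k := 0) Sum.inr
    (φ.relabel (Sum.elim (fun a => (e a).castSucc) fun _ => Fin.last n))) (v ∘ e.symm)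
  refine ⟨X, fun x hx => (hX x hx).trans ?_⟩
  refine (Formula.realize_relabel_sumInr _).trans ?_
  rw [Formula.realize_relabel, hφ]
  simp

theorem IsDef.induction (v : α → M) (h₀ : ∀ x, LeastE x → P v x)
    (hs : ∀ x y, SuccE x y → P v x → P v y) {x : M} (hx : atE x) : P v x := by
  by_contra hPx
  obtain ⟨Y, hY⟩ := IsDef.comprehension hM (P := fun v x => ¬ P v x) h.not v
  obtain ⟨m, ⟨hm, hmY⟩, hmin⟩ := exists_least_atE_subE hM
    (ne_botE_of_subE hM hx ((hY x hx).2 hPx))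
  refine (hY m hm).1 hmY ?_
  by_cases hlm : LeastE m
  · exact h₀ m hlm
  · obtain ⟨y, hy, hym⟩ : ∃ y, atE y ∧ exleE y m := by
      by_contra! H
      exact hlm ⟨hm, H⟩
    obtain ⟨p, hp⟩ := exists_predE hM hm hy hym
    refine hs p m hp (by_contra fun hPp => ?_)
    exact hmin p hp.1 ((hY p hp.1).2 hPp) hp.2.2.1

end Definable

/-! ### Cyclic colourings of the atoms -/

section Coloring

variable {M : Type*} [Lmso.Structure M] {d : ℕ}

/-- `A` partitions the atoms up to `x` into classes visited cyclically, starting at `c`. -/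
def ColorsUpTo (c : Fin d) (x : M) (A : Fin d → M) : Prop :=
  (∀ i y, atE y → subE y (A i) → ¬ exleE x y) ∧
  (∀ y, atE y → ¬ exleE x y → ∃ i, subE y (A i)) ∧
  (∀ i j, i ≠ j → ∀ y, atE y → subE y (A i) → ¬ subE y (A j)) ∧
  (∀ y, LeastE y → subE y (A c)) ∧
  (∀ i y z, subE y (A i) → SuccE y z → ¬ exleE x z → subE z (A (cyc i)))

/-- `A` partitions the atoms into classes visited cyclically, starting at `c`. -/
def Colors (c : Fin d) (A : Fin d → M) : Prop :=
  (∀ y, atE y → ∃ i, subE y (A i)) ∧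
  (∀ i j, i ≠ j → ∀ y, atE y → subE y (A i) → ¬ subE y (A j)) ∧
  (∀ y, LeastE y → subE y (A c)) ∧
  (∀ i y z, subE y (A i) → SuccE y z → subE z (A (cyc i)))

theorem isDef_exists_colorsUpTo (c : Fin d) :
    IsDef fun v : Empty ⊕ Unit → M => ∃ A, ColorsUpTo c (v (.inr ())) A := by
  refine IsDef.exists_tuple (.and ?_ (.and ?_ (.and ?_ (.and ?_ ?_))))
  · exact .forall_finite fun i => .all <| (IsDef.atom _).imp <| (IsDef.sub _ _).imp
      (IsDef.exle _ _).not
  · exact .all <| (IsDef.atom _).imp <| (IsDef.exle _ _).not.imp <|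
      .exists_finite fun i => .sub _ _
  · exact .forall_finite fun i => .forall_finite fun j => (IsDef.const _).imp <| .all <|
      (IsDef.atom _).imp <| (IsDef.sub _ _).imp (IsDef.sub _ _).not
  · exact .all <| (IsDef.least _).imp (.sub _ _)
  · exact .forall_finite fun i => .all <| .all <| (IsDef.sub _ _).imp <|
      (IsDef.succ _ _).imp <| (IsDef.exle _ _).not.imp (.sub _ _)

variable (hM : M ⊨ TMSOFin)
include hM

theorem exists_colorsUpTo_of_leastE (c : Fin d) {x : M} (hx : LeastE x) :
    ∃ A, ColorsUpTo c x A := by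
  have hA : ∀ i, ∃ X : M, ∀ y, atE y → (subE y X ↔ subE y x ∧ i = c) := fun i =>
    IsDef.comprehension hM (α := Unit) (P := fun v y => subE y (v ()) ∧ i = c)
      ((IsDef.sub _ _).and (.const _)) fun _ => x
  choose A hA using hA
  refine ⟨A, fun i y hy h => ?_, fun y hy h => ⟨c, ?_⟩, fun i j hij y hy hi hj => ?_,
    fun y hy => ?_, fun i y z _ hyz hxz => ?_⟩
  · rw [hA i y hy, subE_iff_eq hM hy hx.1] at h
    exact h.1 ▸ exleE_irrefl hM hy
  · rw [hA c y hy, subE_iff_eq hM hy hx.1]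
    exact ⟨((exleE_trichotomy hM hy hx.1).resolve_left (hx.2 y hy)).resolve_right h, rfl⟩
  · exact hij (((hA i y hy).1 hi).2.trans ((hA j y hy).1 hj).2.symm)
  · rw [hA c y hy.1, subE_iff_eq hM hy.1 hx.1]
    exact ⟨hy.unique hM hx, rfl⟩
  · refine absurd ?_ hxz
    rcases exleE_trichotomy hM hx.1 hyz.1 with h | rfl | h
    · exact exleE_trans hM hx.1 hyz.1 hyz.2.1 h hyz.2.2.1
    · exact hyz.2.2.1
    · exact absurd h (hx.2 y hyz.1)

theorem exists_colorsUpTo_of_succE {c : Fin d} {x z : M} (hxz : SuccE x z) {A : Fin d → M}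
    (hA : ColorsUpTo c x A) : ∃ B, ColorsUpTo c z B := by
  obtain ⟨h₁, h₂, h₃, h₄, h₅⟩ := hA
  have hz := hxz.2.1
  obtain ⟨k, hk⟩ := h₂ x hxz.1 (exleE_irrefl hM hxz.1)
  have hB : ∀ i, ∃ X : M, ∀ y, atE y → (subE y X ↔ subE y (A i) ∨ subE y z ∧ i = cyc k) :=
    fun i => IsDef.comprehension hM (α := Bool)
      (P := fun v y => subE y (v true) ∨ subE y (v false) ∧ i = cyc k)
      ((IsDef.sub _ _).or ((IsDef.sub _ _).and (.const _))) fun b => if b then A i else z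
  choose B hB using hB
  replace hB : ∀ i y, atE y → (subE y (B i) ↔ subE y (A i) ∨ y = z ∧ i = cyc k) :=
    fun i y hy => by rw [hB i y hy, subE_iff_eq hM hy hz]
  have hzA : ∀ i, ¬ subE z (A i) := fun i h => h₁ i z hz h hxz.2.2.1
  refine ⟨B, fun i y hy h => ?_, fun y hy h => ?_, fun i j hij y hy hi hj => ?_,
    fun y hy => ?_, fun i y w hy hyw hzw => ?_⟩
  · rcases (hB i y hy).1 h with h | ⟨rfl, -⟩
    · exact hxz.not_exleE hM hy (h₁ i y hy h)
    · exact exleE_irrefl hM hy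
  · rcases hxz.not_exleE_or_eq hy h with h | h
    · obtain ⟨i, hi⟩ := h₂ y hy h
      exact ⟨i, (hB i y hy).2 (.inl hi)⟩
    · exact ⟨cyc k, (hB _ y hy).2 (.inr ⟨h, rfl⟩)⟩
  · rcases (hB i y hy).1 hi with hi | ⟨rfl, hi⟩ <;> rcases (hB j y hy).1 hj with hj | ⟨hyz, hj⟩
    · exact h₃ i j hij y hy hi hj
    · exact hzA i (hyz ▸ hi)
    · exact hzA j hj
    · exact hij (hi.trans hj.symm)
  · exact (hB c y hy.1).2 (.inl (h₄ y hy))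
  · have hyz : y ≠ z := by
      rintro rfl
      exact hzw hyw.2.2.1
    have hyA : subE y (A i) := ((hB i y hyw.1).1 hy).resolve_right fun h => hyz h.1
    refine (hB _ w hyw.2.1).2 ?_
    rcases hxz.not_exleE_or_eq hyw.2.1 hzw with h | rfl
    · exact .inl (h₅ i y w hyA hyw h)
    · refine .inr ⟨rfl, ?_⟩
      obtain rfl := hxz.left_unique hM hyw
      by_contra hne
      exact h₃ i k (fun h => hne (h ▸ rfl)) x hxz.1 hyA hk

theorem exists_colors (c : Fin d) {a : M} (ha : atE a) : ∃ A : Fin d → M, Colors c A := by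
  obtain ⟨g, hg⟩ := exists_greatestE hM ha
  obtain ⟨A, -, h₂, h₃, h₄, h₅⟩ := IsDef.induction hM
    (P := fun _ x => ∃ A, ColorsUpTo c x A) (isDef_exists_colorsUpTo c) Empty.elim
    (fun x hx => exists_colorsUpTo_of_leastE hM c hx)
    (fun x y hxy ⟨A, hA⟩ => exists_colorsUpTo_of_succE hM hxy hA) hg.1
  exact ⟨A, fun y hy => h₂ y hy (hg.2 y hy), h₃, h₄,
    fun i y z hy hyz => h₅ i y z hy hyz (hg.2 z hyz.2.1)⟩

theorem Colors.subE_iff {c : Fin d} {A B : Fin d → M} (hA : Colors c A) (hB : Colors c B)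
    {x : M} (hx : atE x) (i : Fin d) : subE x (A i) ↔ subE x (B i) := by
  have aux : ∀ {x : M} {k : Fin d}, atE x → subE x (A k) → subE x (B k) →
      ∀ i, subE x (A i) ↔ subE x (B i) := by
    intro x k hx hAk hBk i
    by_cases hik : i = k
    · subst hik
      exact iff_of_true hAk hBk
    · exact iff_of_false (fun h => hA.2.1 i k hik x hx h hAk)
        fun h => hB.2.1 i k hik x hx h hBk
  refine IsDef.induction hM (α := Fin d ⊕ Fin d)
    (P := fun v x => ∀ i, subE x (v (.inl i)) ↔ subE x (v (.inr i)))
    (.forall_finite fun i => (IsDef.sub _ _).iff (.sub _ _)) (Sum.elim A B)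
    (fun x hx => ?_) (fun x y hxy h => ?_) hx i
  · exact aux hx.1 (hA.2.2.1 x hx) (hB.2.2.1 x hx)
  · obtain ⟨k, hk⟩ := hA.1 x hxy.1
    exact aux hxy.2.1 (hA.2.2.2 k x y hk hxy) (hB.2.2.2 k x y ((h k).1 hk) hxy)

theorem Colors.ne_botE [Infinite M] {hd : 0 < d} {A : Fin d → M} (hA : Colors ⟨0, hd⟩ A)
    (i : Fin d) : A i ≠ botE M := by
  have key : ∀ k : ℕ, ∃ a : M, atE a ∧ {y | atE y ∧ ¬ exleE a y}.Finite ∧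
      subE a (A ⟨k % d, Nat.mod_lt _ hd⟩) := by
    intro k
    induction k with
    | zero =>
      obtain ⟨y, hy⟩ := (infinite_setOf_atE hM).nonempty
      obtain ⟨l, hl⟩ := exists_leastE hM hy
      refine ⟨l, hl.1, (Set.finite_singleton l).subset fun y hy => ?_, ?_⟩
      · exact ((exleE_trichotomy hM hy.1 hl.1).resolve_left (hl.2 y hy.1)).resolve_right hy.2
      · simpa using hA.2.2.1 l hl
    | succ k ih =>
      obtain ⟨a, ha, hfin, hak⟩ := ih
      obtain ⟨b, hb, hab⟩ : ∃ b, atE b ∧ exleE a b := by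
        by_contra! H
        exact infinite_setOf_atE hM (hfin.subset fun y hy => ⟨hy, H y hy⟩)
      obtain ⟨s, hs⟩ := exists_succE hM ha hb hab
      refine ⟨s, hs.2.1, (hfin.insert s).subset fun y hy => ?_, ?_⟩
      · rcases hs.not_exleE_or_eq hy.1 hy.2 with h | h
        · exact .inr ⟨hy.1, h⟩
        · exact .inl h
      · simpa [cyc] using hA.2.2.2 _ a s hak hs
  obtain ⟨a, ha, -, hai⟩ := key i
  exact ne_botE_of_subE hM ha (by simpa [Nat.mod_eq_of_lt i.2] using hai)

theorem realize_rho_iff [Infinite M] {h : ℕ} (hd : 0 < d) (hh : 0 < h) (hhd : h ≤ d) :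
    M ⊨ rho d h ↔ ∃ A : Fin d → M, Colors ⟨0, hd⟩ A ∧
      ∀ x, GreatestE x → subE x (A ⟨h - 1, by omega⟩) := by
  have e : ∀ k (hk : 0 < k) (hkd : k ≤ d), aIdx d k hd = ⟨k - 1, by omega⟩ := by
    intro k hk hkd
    ext
    simp only [aIdx]
    rw [show k + d - 1 = k - 1 + d by omega, Nat.add_mod_right, Nat.mod_eq_of_lt (by omega)]
  rw [realize_rho d h hd, e h hh hhd, e 1 one_pos hd]
  refine exists_congr fun A => ⟨?_, ?_⟩
  · rintro ⟨-, h₁, h₂, h₃, h₄, h₅⟩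
    refine ⟨⟨h₁, fun i j hij x hx hi hj => ?_, h₃, h₄⟩, h₅⟩
    rcases lt_or_gt_of_ne hij with hij | hij
    · exact h₂ i j hij x hx ⟨hi, hj⟩
    · exact h₂ j i hij x hx ⟨hj, hi⟩
  · rintro ⟨hA, h₅⟩
    exact ⟨hA.ne_botE hM, hA.1, fun i j hij x hx h => hA.2.1 i j hij.ne x hx h.1 h.2,
      hA.2.2.1, hA.2.2.2, h₅⟩

end Coloring

theorem statement10 (M : Type) [Lmso.Structure M] (hM : M ⊨ TMSOFin) (hinf : Infinite M)
    (d : ℕ) (hd : 1 ≤ d) :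
    ∃! h : ℕ, (0 < h ∧ h ≤ d) ∧ M ⊨ rho d h := by
  obtain ⟨a, ha⟩ := (infinite_setOf_atE hM).nonempty
  obtain ⟨g, hg⟩ := exists_greatestE hM ha
  obtain ⟨A, hA⟩ := exists_colors hM (⟨0, hd⟩ : Fin d) ha
  obtain ⟨i, hi⟩ := hA.1 g hg.1
  refine ⟨i + 1, ⟨⟨by omega, i.2⟩, ?_⟩, ?_⟩
  · refine (realize_rho_iff hM hd (by omega) i.2).2 ⟨A, hA, fun x hx => ?_⟩
    have hxg : x = g := ((exleE_trichotomy hM hx.1 hg.1).resolve_left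
      (hx.2 g hg.1)).resolve_right (hg.2 x hx.1)
    exact hxg ▸ hi
  · rintro h ⟨⟨hh, hhd⟩, hρ⟩
    obtain ⟨B, hB, hgB⟩ := (realize_rho_iff hM hd hh hhd).1 hρ
    have hgA := (hA.subE_iff hM hB hg.1 _).2 (hgB g hg)
    by_contra hne
    refine hA.2.1 _ i (fun e => hne ?_) g hg.1 hgA hi
    have := congrArg Fin.val e
    simp only at this
    omega

end MSO
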